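/- arXiv:1506.04173 — 2 statements merged into one kernel-verified Lean document; each statement's English description precedes it below -/
import Mathlib

section
/- For a 3×3 Boggle board with nine distinct letters, 377 four-letter words guarantee a unique solution. Precisely: if B : Fin 3 × Fin 3 → Fin 9 is a bijection and P ⊆ W₄(B) is a set of four-letter words of B with cardinality at least 377, then every bijection B' : Fin 3 × Fin 3 → Fin 9 with P ⊆ W₄(B') is equivalent to B. -/
/-- King-move adjacency on the cells of a 3×3 grid: two cells are adjacent if they are
distinct and their coordinates differ by at most 1 in each component. -/
def cellAdj (a b : Fin 3 × Fin 3) : Prop :=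
  a ≠ b ∧ |(a.1.val : ℤ) - (b.1.val : ℤ)| ≤ 1 ∧ |(a.2.val : ℤ) - (b.2.val : ℤ)| ≤ 1

/-- `w` is a word of the board `B`: a list of letters of length at least 2 of the form
`B c₁, …, B c_k` where the cells `c₁, …, c_k` are pairwise distinct and consecutive
cells are adjacent.  (For a bijective board this says exactly that `w` is a list of
pairwise distinct letters whose consecutive letters occupy adjacent cells.) -/
def IsWordOf {A : Type*} (B : Fin 3 × Fin 3 → A) (w : List A) : Prop :=
  2 ≤ w.length ∧
    ∃ cs : List (Fin 3 × Fin 3), cs.map B = w ∧ cs.Nodup ∧ cs.Chain' cellAdj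

/-- The set `W(B)` of all words of the board `B`. -/
def Words {A : Type*} (B : Fin 3 × Fin 3 → A) : Set (List A) :=
  {w | IsWordOf B w}

/-- The set `W_k(B)` of all `k`-letter words of the board `B`. -/
def WordsOfLen {A : Type*} (B : Fin 3 × Fin 3 → A) (k : ℕ) : Set (List A) :=
  {w | w.length = k ∧ IsWordOf B w}

/-- Rotation of the 3×3 grid by 90 degrees. -/
def rotCell (c : Fin 3 × Fin 3) : Fin 3 × Fin 3 := (c.2, 2 - c.1)

/-- Reflection of the 3×3 grid along the main diagonal. -/
def reflCell (c : Fin 3 × Fin 3) : Fin 3 × Fin 3 := (c.2, c.1)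

/-- The symmetry group of the square acting on the 3×3 grid: the eight
rotations and reflections. -/
def squareSymm : Set ((Fin 3 × Fin 3) → (Fin 3 × Fin 3)) :=
  {id, rotCell, rotCell ∘ rotCell, rotCell ∘ rotCell ∘ rotCell,
   reflCell, reflCell ∘ rotCell, reflCell ∘ rotCell ∘ rotCell,
   reflCell ∘ rotCell ∘ rotCell ∘ rotCell}

/-- Two boards are equivalent if one is obtained from the other by a symmetry
of the square. -/
def BoardEquiv {A : Type*} (B B' : Fin 3 × Fin 3 → A) : Prop :=
  ∃ σ ∈ squareSymm, B' = B ∘ σ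

/-! ### Numerical encoding of the grid -/

/-- The cell `(i, j)` is encoded by the number `3 * i + j`. -/
def cellCode (c : Fin 3 × Fin 3) : ℕ := 3 * c.1.val + c.2.val

/-- The inverse of `cellCode` on numbers below `9`. -/
def cellOfCode (n : ℕ) : Fin 3 × Fin 3 := (Fin.ofNat 3 (n / 3), Fin.ofNat 3 n)

/-- King-move adjacency in terms of cell codes. -/
def kingAdj (a b : ℕ) : Bool :=
  !Nat.beq a b && Nat.ble (a / 3) (b / 3 + 1) && Nat.ble (b / 3) (a / 3 + 1) &&
    Nat.ble (a % 3) (b % 3 + 1) && Nat.ble (b % 3) (a % 3 + 1)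

theorem cellCode_lt (c : Fin 3 × Fin 3) : cellCode c < 9 := by
  unfold cellCode; omega

theorem cellOfCode_cellCode (c : Fin 3 × Fin 3) : cellOfCode (cellCode c) = c := by
  revert c; decide

theorem cellCode_cellOfCode {n : ℕ} (hn : n < 9) : cellCode (cellOfCode n) = n := by
  revert n; decide

theorem kingAdj_cellCode {a b : Fin 3 × Fin 3} (h : cellAdj a b) :
    kingAdj (cellCode a) (cellCode b) = true := by
  revert a b
  unfold cellAdj
  decide +kernel

theorem kingAdj_comm (a b : ℕ) : kingAdj a b = kingAdj b a := by
  rw [Bool.eq_iff_iff]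
  simp only [kingAdj, Bool.and_eq_true, Bool.not_eq_true', Nat.beq_eq, Nat.ble_eq, ← Bool.not_eq_true]
  omega

/-- The step from cell code `a` to cell code `b`. -/
def stepCode (a b : ℕ) : ℕ := Nat.add (Nat.mul 9 a) b

/-- The bit mask of a list of numbers. -/
def bitMask : List ℕ → ℕ
  | [] => 0
  | i :: l => Nat.lor (Nat.pow 2 i) (bitMask l)

theorem testBit_bitMask (l : List ℕ) (i : ℕ) : (bitMask l).testBit i = true ↔ i ∈ l := by
  induction l with
  | nil => simp [bitMask]
  | cons j l ih =>
    have h : bitMask (j :: l) = 2 ^ j ||| bitMask l := rfl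
    simp [h, Nat.testBit_or, ih, Nat.testBit_two_pow, @eq_comm _ i j]

/-- The self-avoiding king paths with four cells, as quadruples of cell codes. -/
def kingPaths : List (ℕ × ℕ × ℕ × ℕ) :=
  (List.range 9).flatMap fun a =>
  ((List.range 9).filter (kingAdj a)).flatMap fun b =>
  ((List.range 9).filter fun c => kingAdj b c && c != a).flatMap fun c =>
  ((List.range 9).filter fun d => kingAdj c d && d != a && d != b).map fun d => (a, b, c, d)

/-- The bit mask of the steps of a path. -/
def pathMask (p : ℕ × ℕ × ℕ × ℕ) : ℕ :=
  bitMask [stepCode p.1 p.2.1, stepCode p.2.1 p.2.2.1, stepCode p.2.2.1 p.2.2.2]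

def kingPathMasks : List ℕ := kingPaths.map pathMask

/-- The step codes of a list of edges, in both directions. -/
def edgeSteps (S : List (ℕ × ℕ)) : List ℕ :=
  S.flatMap fun e => [stepCode e.1 e.2, stepCode e.2 e.1]

/-- The number of masks in a list that are disjoint from `m`. -/
def countDisjoint (m : ℕ) (l : List ℕ) : ℕ :=
  l.rec 0 fun p _ n => bif Nat.beq (Nat.land p m) 0 then Nat.succ n else n

/-- At most 376 four-cell paths avoid all the edges in `S`. The recursor makes the kernel evaluate
the bit mask only once. -/
def fewPathsAvoid (S : List (ℕ × ℕ)) : Bool :=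
  Nat.rec (motive := fun _ => Bool) (Nat.ble (countDisjoint 0 kingPathMasks) 376)
    (fun k _ => Nat.ble (countDisjoint (Nat.succ k) kingPathMasks) 376) (bitMask (edgeSteps S))

/-- The edges of the king graph induced on the cells in a list. -/
def kingEdges : List ℕ → List (ℕ × ℕ)
  | [] => []
  | k :: l => ((l.filter fun i => kingAdj i k).map fun i => (i, k)) ++ kingEdges l

/-- The cells, in the reverse of the order in which the search assigns images. -/
def cellOrder : List ℕ := [8, 6, 2, 0, 7, 5, 3, 1, 4]

theorem fewPathsAvoid_of_three :
    ((kingEdges cellOrder).sublistsLen 3).all fewPathsAvoid = true := by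
  decide +kernel

/-- The edges joining cell `k` to the cells assigned in `t` that are not preserved when the
partial assignment `t` is extended by `k ↦ v`. -/
def newLostEdges (t : List (ℕ × ℕ)) (k v : ℕ) : List (ℕ × ℕ) :=
  (t.filter fun e => kingAdj e.1 k && !kingAdj e.2 v).map fun e => (e.1, k)

/-- The eight symmetries of the square. -/
def symmList : List (Fin 3 × Fin 3 → Fin 3 × Fin 3) :=
  [id, rotCell, rotCell ∘ rotCell, rotCell ∘ rotCell ∘ rotCell,
    reflCell, reflCell ∘ rotCell, reflCell ∘ rotCell ∘ rotCell,
    reflCell ∘ rotCell ∘ rotCell ∘ rotCell]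

/-- Whether an assignment of images to cells is the restriction of a symmetry of the square. -/
def isSymmAssignment (t : List (ℕ × ℕ)) : Bool :=
  symmList.any fun σ => t.all fun e => Nat.beq (cellCode (σ (cellOfCode e.1))) e.2

/-- Exhaustive search over all ways to extend the assignment `t` injectively to the cells `ks`,
where `S` is the list of edges lost so far: every extension is a symmetry of the square, or loses
three edges, or loses edges that are avoided by few paths. -/
def searchExtensions : List ℕ → List (ℕ × ℕ) → List (ℕ × ℕ) → Bool
  | [], t, S => isSymmAssignment t || fewPathsAvoid S
  | k :: ks, t, S => [0, 1, 2, 3, 4, 5, 6, 7, 8].all fun v =>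
      t.any (fun e => Nat.beq e.2 v) || Nat.ble 3 (newLostEdges t k v ++ S).length ||
        searchExtensions ks ((k, v) :: t) (newLostEdges t k v ++ S)

theorem searchExtensions_center :
    searchExtensions [1, 3, 5, 7, 0, 2, 6, 8] [(4, 4)] [] = true := by
  decide +kernel

theorem kingEdges_cellOrder_lt :
    ∀ e ∈ kingEdges cellOrder, e.1 < 9 ∧ e.2 < 9 := by
  decide +kernel

/-- The number of four-cell paths that `f` maps to king paths is at most `376`. -/
def FewPreserved (f : ℕ → ℕ) : Prop :=
  (kingPaths.filter fun p => kingAdj (f p.1) (f p.2.1) && kingAdj (f p.2.1) (f p.2.2.1) &&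
    kingAdj (f p.2.2.1) (f p.2.2.2)).length ≤ 376

theorem countDisjoint_eq (m : ℕ) (l : List ℕ) :
    countDisjoint m l = l.countP fun p => Nat.beq (Nat.land p m) 0 := by
  induction l with
  | nil => rfl
  | cons p l ih =>
    rw [List.countP_cons, ← ih]
    change (bif Nat.beq (Nat.land p m) 0 then Nat.succ (countDisjoint m l)
      else countDisjoint m l) = _
    cases Nat.beq (Nat.land p m) 0 <;> rfl

theorem fewPathsAvoid_iff (S : List (ℕ × ℕ)) :
    fewPathsAvoid S = true ↔ countDisjoint (bitMask (edgeSteps S)) kingPathMasks ≤ 376 := by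
  unfold fewPathsAvoid
  cases bitMask (edgeSteps S) <;> exact Iff.of_eq Nat.ble_eq

theorem kingPaths_lt : ∀ p ∈ kingPaths, p.1 < 9 ∧ p.2.1 < 9 ∧ p.2.2.1 < 9 ∧ p.2.2.2 < 9 := by
  intro p hp
  simp only [kingPaths, List.mem_flatMap, List.mem_map, List.mem_filter, List.mem_range] at hp
  obtain ⟨a, ha, b, hb, c, hc, d, hd, rfl⟩ := hp
  exact ⟨ha, hb.1, hc.1, hd.1⟩

theorem stepCode_notMem_edgeSteps {f : ℕ → ℕ} {S : List (ℕ × ℕ)}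
    (hS : ∀ e ∈ S, (e.1 < 9 ∧ e.2 < 9) ∧ kingAdj (f e.1) (f e.2) = false)
    {a b : ℕ} (hb : b < 9) (hab : kingAdj (f a) (f b) = true) :
    stepCode a b ∉ edgeSteps S := by
  intro h
  simp only [edgeSteps, List.mem_flatMap, List.mem_cons, List.not_mem_nil, or_false] at h
  obtain ⟨e, he, h⟩ := h
  obtain ⟨⟨h1, h2⟩, hl⟩ := hS e he
  have key : ∀ x y, y < 9 → stepCode a b = stepCode x y → a = x ∧ b = y := by
    intro x y hy hxy
    change 9 * a + b = 9 * x + y at hxy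
    omega
  rcases h with h | h
  · obtain ⟨rfl, rfl⟩ := key _ _ h2 h
    simp [hl] at hab
  · obtain ⟨rfl, rfl⟩ := key _ _ h1 h
    rw [kingAdj_comm] at hab
    simp [hl] at hab

theorem fewPreserved_of_fewPathsAvoid {f : ℕ → ℕ} {S : List (ℕ × ℕ)}
    (hS : ∀ e ∈ S, (e.1 < 9 ∧ e.2 < 9) ∧ kingAdj (f e.1) (f e.2) = false)
    (h : fewPathsAvoid S = true) : FewPreserved f := by
  rw [fewPathsAvoid_iff, countDisjoint_eq, kingPathMasks, List.countP_map] at h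
  refine le_trans ?_ h
  rw [← List.countP_eq_length_filter]
  refine List.countP_mono_left fun p hp hf => ?_
  simp only [Bool.and_eq_true] at hf
  obtain ⟨-, h2, h3, h4⟩ := kingPaths_lt p hp
  simp only [Function.comp_apply, Nat.beq_eq]
  apply Nat.eq_of_testBit_eq
  intro i
  change (pathMask p &&& bitMask (edgeSteps S)).testBit i = _
  rw [Nat.testBit_and, Nat.zero_testBit, Bool.and_eq_false_iff, ← Bool.not_eq_true,
    ← Bool.not_eq_true, testBit_bitMask, pathMask, testBit_bitMask, ← not_and_or]
  rintro ⟨hi, hi'⟩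
  simp only [List.mem_cons, List.not_mem_nil, or_false] at hi
  rcases hi with rfl | rfl | rfl
  · exact stepCode_notMem_edgeSteps hS h2 hf.1.1 hi'
  · exact stepCode_notMem_edgeSteps hS h3 hf.1.2 hi'
  · exact stepCode_notMem_edgeSteps hS h4 hf.2 hi'

/-- A map losing three edges preserves few paths. -/
theorem fewPreserved_of_three {f : ℕ → ℕ} {S : List (ℕ × ℕ)} (hn : S.Nodup)
    (hE : S ⊆ kingEdges cellOrder) (hS : ∀ e ∈ S, kingAdj (f e.1) (f e.2) = false)
    (h3 : 3 ≤ S.length) : FewPreserved f := by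
  obtain ⟨s, hs, hsE⟩ := hn.subperm hE
  have hmem : s.take 3 ∈ (kingEdges cellOrder).sublistsLen 3 :=
    List.mem_sublistsLen.2 ⟨(List.take_sublist 3 s).trans hsE, by
      rw [List.length_take, hs.length_eq]; omega⟩
  refine fewPreserved_of_fewPathsAvoid (fun e he => ?_)
    (List.all_eq_true.1 fewPathsAvoid_of_three _ hmem)
  have he' := List.mem_of_mem_take he
  exact ⟨kingEdges_cellOrder_lt e (hsE.subset he'), hS e (hs.subset he')⟩

theorem kingEdges_cellOrder_nodup : (kingEdges cellOrder).Nodup := by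
  decide +kernel

theorem newLostEdges_sublist (f : ℕ → ℕ) (l : List ℕ) (k : ℕ) :
    (newLostEdges (l.map fun i => (i, f i)) k (f k)).Sublist
      ((l.filter fun i => kingAdj i k).map fun i => (i, k)) := by
  rw [newLostEdges, List.filter_map, List.map_map]
  exact (List.monotone_filter_right l fun i hi => by
    simp only [Function.comp_apply, Bool.and_eq_true] at hi; exact hi.1).map _

theorem kingAdj_of_mem_newLostEdges {f : ℕ → ℕ} {l : List ℕ} {k : ℕ} {e : ℕ × ℕ}
    (he : e ∈ newLostEdges (l.map fun i => (i, f i)) k (f k)) :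
    kingAdj (f e.1) (f e.2) = false := by
  simp only [newLostEdges, List.mem_map, List.mem_filter, Bool.and_eq_true,
    Bool.not_eq_true'] at he
  obtain ⟨_, ⟨⟨i, -, rfl⟩, -, h⟩, rfl⟩ := he
  exact h

theorem kingEdges_sublist_reverseAux (ks l : List ℕ) :
    (kingEdges l).Sublist (kingEdges (ks.reverseAux l)) := by
  induction ks generalizing l with
  | nil => exact List.Sublist.refl _
  | cons k ks ih => exact (List.sublist_append_right _ _).trans (ih (k :: l))

theorem searchExtensions_sound {f : ℕ → ℕ} (hf : Set.InjOn f (Set.Iio 9))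
    (hlt : ∀ i < 9, f i < 9) (ks l : List ℕ) (S : List (ℕ × ℕ))
    (hks : ks.reverseAux l = cellOrder) (hSl : S.Sublist (kingEdges l))
    (hS : ∀ e ∈ S, kingAdj (f e.1) (f e.2) = false)
    (h : searchExtensions ks (l.map fun i => (i, f i)) S = true) :
    isSymmAssignment (cellOrder.map fun i => (i, f i)) = true ∨ FewPreserved f := by
  induction ks generalizing l S with
  | nil =>
    obtain rfl : l = cellOrder := hks
    rw [searchExtensions, Bool.or_eq_true] at h
    exact h.imp_right (fewPreserved_of_fewPathsAvoid fun e he =>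
      ⟨kingEdges_cellOrder_lt e (hSl.subset he), hS e he⟩)
  | cons k ks ih =>
    have hperm : (ks.reverseAux (k :: l)).Perm (ks ++ k :: l) := by
      rw [List.reverseAux_eq]; exact (List.reverse_perm ks).append_right _
    rw [show ks.reverseAux (k :: l) = cellOrder from hks] at hperm
    have hcell : ∀ i ∈ cellOrder, i < 9 := by decide
    have hnodup : (k :: l).Nodup :=
      (List.nodup_append.1 (hperm.nodup_iff.1 (by decide))).2.1
    have hltl : ∀ i ∈ k :: l, i < 9 := fun i hi =>
      hcell i (hperm.mem_iff.2 (List.mem_append_right _ hi))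
    have hk := hltl k List.mem_cons_self
    have hS' : ∀ e ∈ newLostEdges (l.map fun i => (i, f i)) k (f k) ++ S,
        kingAdj (f e.1) (f e.2) = false := fun e he =>
      (List.mem_append.1 he).elim kingAdj_of_mem_newLostEdges (hS e)
    have hSl' : (newLostEdges (l.map fun i => (i, f i)) k (f k) ++ S).Sublist
        (kingEdges (k :: l)) := (newLostEdges_sublist f l k).append hSl
    rw [searchExtensions, List.all_eq_true] at h
    have h := h (f k) (by have := hlt k hk; simp only [List.mem_cons]; omega)
    rw [Bool.or_eq_true, Bool.or_eq_true] at h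
    rcases h with (h | h) | h
    · simp only [List.any_map, List.any_eq_true, Function.comp_apply, Nat.beq_eq] at h
      obtain ⟨i, hi, hik⟩ := h
      have := hf (hltl i (List.mem_cons_of_mem _ hi)) hk hik
      exact absurd (this ▸ hi) (List.nodup_cons.1 hnodup).1
    · have hE := hSl'.trans (hks ▸ kingEdges_sublist_reverseAux ks (k :: l))
      exact Or.inr (fewPreserved_of_three (hE.nodup kingEdges_cellOrder_nodup) hE.subset hS'
        (Nat.ble_eq.mp h))
    · exact ih (k :: l) _ hks hSl' hS' h

theorem exists_three_not_kingAdj {v : ℕ} (hv : v < 9) (hv4 : v ≠ 4) :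
    ∃ s ∈ (List.range 9).sublistsLen 3, ∀ w ∈ s, w ≠ v ∧ kingAdj v w = false := by
  revert v; decide +kernel

theorem center_mem_kingEdges {i : ℕ} (hi : i < 9) (hi4 : i ≠ 4) :
    (4, i) ∈ kingEdges cellOrder := by
  revert i; decide +kernel

/-- A map that moves the center loses at least three of the eight edges there. -/
theorem fewPreserved_of_center {f : ℕ → ℕ} (hlt : ∀ i < 9, f i < 9)
    (hsurj : ∀ w < 9, ∃ i < 9, f i = w) (h4 : f 4 ≠ 4) : FewPreserved f := by
  obtain ⟨s, hs, hsv⟩ := exists_three_not_kingAdj (hlt 4 (by norm_num)) h4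
  rw [List.mem_sublistsLen] at hs
  have hs9 : ∀ w ∈ s, w < 9 := fun w hw => List.mem_range.1 (hs.1.subset hw)
  choose! g hg9 hg using hsurj
  have hinj : ∀ w ∈ s, ∀ w' ∈ s, (4, g w) = (4, g w') → w = w' := by
    intro w hw w' hw' h
    rw [← hg w (hs9 w hw), ← hg w' (hs9 w' hw'), (Prod.mk.inj h).2]
  refine fewPreserved_of_three (S := s.map fun w => (4, g w))
    ((hs.1.nodup List.nodup_range).map_on hinj) ?_ ?_ (by simp [hs.2])
  · intro e he
    obtain ⟨w, hw, rfl⟩ := List.mem_map.1 he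
    refine center_mem_kingEdges (hg9 w (hs9 w hw)) fun h => (hsv w hw).1 ?_
    rw [← hg w (hs9 w hw), h]
  · intro e he
    obtain ⟨w, hw, rfl⟩ := List.mem_map.1 he
    simpa [hg w (hs9 w hw)] using (hsv w hw).2

/-- A permutation of the cells is a symmetry of the square or maps at most 376 four-cell paths to
four-cell paths. -/
theorem mem_squareSymm_or_fewPreserved (τ : Equiv.Perm (Fin 3 × Fin 3)) :
    ⇑τ ∈ squareSymm ∨ FewPreserved fun n => cellCode (τ (cellOfCode n)) := by
  set f : ℕ → ℕ := fun n => cellCode (τ (cellOfCode n)) with hf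
  have hlt : ∀ i < 9, f i < 9 := fun i _ => cellCode_lt _
  by_cases h4 : f 4 = 4
  · have hinj : Set.InjOn f (Set.Iio 9) := by
      intro i hi j hj hij
      have h := congrArg cellOfCode hij
      simp only [hf, cellOfCode_cellCode, EmbeddingLike.apply_eq_iff_eq] at h
      rw [← cellCode_cellOfCode hi, h, cellCode_cellOfCode hj]
    have h0 : searchExtensions [1, 3, 5, 7, 0, 2, 6, 8] ([4].map fun i => (i, f i)) [] = true := by
      simpa only [List.map_cons, List.map_nil, h4] using searchExtensions_center
    refine (searchExtensions_sound hinj hlt _ _ _ rfl (List.nil_sublist _)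
      (by simp) h0).imp_left fun h => ?_
    simp only [isSymmAssignment, List.any_eq_true, List.all_map, List.all_eq_true,
      Function.comp_apply, Nat.beq_eq] at h
    obtain ⟨σ, hσ, h⟩ := h
    have hτ : ⇑τ = σ := by
      funext c
      have hc := h (cellCode c) (by
        have := cellCode_lt c; simp only [cellOrder, List.mem_cons]; omega)
      simp only [hf, cellOfCode_cellCode] at hc
      rw [← cellOfCode_cellCode (τ c), ← hc, cellOfCode_cellCode]
    rw [hτ]
    simpa [symmList, squareSymm] using hσ
  · refine Or.inr (fewPreserved_of_center hlt (fun w hw => ?_) h4)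
    exact ⟨cellCode (τ.symm (cellOfCode w)), cellCode_lt _, by
      simp [hf, cellOfCode_cellCode, cellCode_cellOfCode hw]⟩

theorem mem_kingPaths {a b c d : Fin 3 × Fin 3} (hn : [a, b, c, d].Nodup)
    (hc : List.IsChain cellAdj [a, b, c, d]) :
    (cellCode a, cellCode b, cellCode c, cellCode d) ∈ kingPaths := by
  have hinj : ∀ {x y}, x ≠ y → cellCode x ≠ cellCode y := fun h h' =>
    h (Function.LeftInverse.injective cellOfCode_cellCode h')
  simp only [List.isChain_cons_cons, List.nodup_cons, List.mem_cons, not_or] at hn hc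
  simp only [kingPaths, List.mem_flatMap, List.mem_map, List.mem_filter, List.mem_range,
    Bool.and_eq_true, bne_iff_ne]
  exact ⟨_, cellCode_lt a, _, ⟨cellCode_lt b, kingAdj_cellCode hc.1⟩, _,
    ⟨cellCode_lt c, kingAdj_cellCode hc.2.1, hinj (Ne.symm hn.1.2.1)⟩, _,
    ⟨cellCode_lt d, ⟨kingAdj_cellCode hc.2.2.1, hinj (Ne.symm hn.1.2.2.1)⟩,
      hinj (Ne.symm hn.2.1.2.1)⟩, rfl⟩

/-- For a 3×3 board with nine distinct letters, 377 4-letter words of the board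
guarantee a unique solution up to symmetry. -/
theorem words_guarantee_unique (B : Fin 3 × Fin 3 → Fin 9) (hB : Function.Bijective B)
    (P : Finset (List (Fin 9)))
    (hP : ↑P ⊆ WordsOfLen B 4)
    (hcard : 377 ≤ P.card)
    (B' : Fin 3 × Fin 3 → Fin 9) (hB' : Function.Bijective B')
    (hP' : ↑P ⊆ WordsOfLen B' 4) :
    BoardEquiv B B' := by
  let τ : Equiv.Perm (Fin 3 × Fin 3) :=
    (Equiv.ofBijective B' hB').trans (Equiv.ofBijective B hB).symm
  have hτ : ∀ c, B (τ c) = B' c := fun c =>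
    (Equiv.ofBijective B hB).apply_symm_apply (B' c)
  rcases mem_squareSymm_or_fewPreserved τ with h | h
  · exact ⟨τ, h, funext fun c => (hτ c).symm⟩
  exfalso
  set f : ℕ → ℕ := fun n => cellCode (τ (cellOfCode n)) with hf
  have hfc : ∀ c, f (cellCode c) = cellCode (τ c) := fun c => by
    simp only [hf, cellOfCode_cellCode]
  let word : ℕ × ℕ × ℕ × ℕ → List (Fin 9) := fun p =>
    [p.1, p.2.1, p.2.2.1, p.2.2.2].map fun n => B' (cellOfCode n)
  suffices hsub : P ⊆ ((kingPaths.filter fun p => kingAdj (f p.1) (f p.2.1) &&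
      kingAdj (f p.2.1) (f p.2.2.1) && kingAdj (f p.2.2.1) (f p.2.2.2)).map word).toFinset by
    have h1 := Finset.card_le_card hsub
    have h2 := h1.trans (List.toFinset_card_le _)
    rw [List.length_map] at h2
    exact absurd (hcard.trans (h2.trans h)) (by norm_num)
  intro w hw
  obtain ⟨hlen, -, cs, rfl, hn, hc⟩ := hP' hw
  obtain ⟨-, -, ds, hds, -, hd⟩ := hP hw
  have hdc : ds = cs.map τ := by
    apply hB.injective.list_map
    rw [hds, List.map_map]
    exact List.map_congr_left fun c _ => (hτ c).symm
  subst hdc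
  rw [List.length_map] at hlen
  obtain ⟨a, b, c, d, rfl⟩ := List.length_eq_four.1 hlen
  replace hd : List.IsChain cellAdj [τ a, τ b, τ c, τ d] := hd
  simp only [List.isChain_cons_cons] at hd
  rw [List.mem_toFinset, List.mem_map]
  refine ⟨_, List.mem_filter.2 ⟨mem_kingPaths hn hc, ?_⟩, ?_⟩
  · simp only [hfc, Bool.and_eq_true]
    exact ⟨⟨kingAdj_cellCode hd.1, kingAdj_cellCode hd.2.1⟩, kingAdj_cellCode hd.2.2.1⟩
  · simp only [word, List.map_cons, List.map_nil, cellOfCode_cellCode]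
end

section
/- The standard board S and the board [(1 3)] obtained by swapping its two upper corners are not equivalent, yet they have exactly 376 four-letter words in common: the cardinality of W₄(S) ∩ W₄([(1 3)]) is 376. Hence 376 four-letter words do not suffice to guarantee a unique solution. -/
/-- The standard board `S`: the border cells, read clockwise from the top-left
corner, carry the letters `0,…,7` and the center cell carries the letter `8`
(letters are 0-indexed, so paper letter `i` is `i - 1 : Fin 9`). -/
def stdBoard : Fin 3 × Fin 3 → Fin 9 := fun c =>
  ![![(0 : Fin 9), 1, 2], ![7, 8, 3], ![6, 5, 4]] c.1 c.2

/-- The board `[(1 3)]` obtained from the standard board by swapping the two upper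
corner letters (paper letters 1 and 3, i.e. `0` and `2 : Fin 9`). -/
def swapBoard : Fin 3 × Fin 3 → Fin 9 :=
  (Equiv.swap (0 : Fin 9) 2) ∘ stdBoard

instance (a b : Fin 3 × Fin 3) : Decidable (cellAdj a b) :=
  inferInstanceAs (Decidable (_ ∧ _ ∧ _))

/-- For a board with two-sided inverse `g`, words are the lists of distinct letters whose
consecutive letters occupy adjacent cells. -/
theorem isWordOf_iff_of_inverse {A : Type*} {B : Fin 3 × Fin 3 → A} {g : A → Fin 3 × Fin 3}
    (hl : Function.LeftInverse g B) (hr : Function.RightInverse g B) (w : List A) :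
    IsWordOf B w ↔ 2 ≤ w.length ∧ w.Nodup ∧ w.IsChain fun a b => cellAdj (g a) (g b) := by
  refine and_congr_right fun _ => ⟨?_, fun ⟨hn, hc⟩ => ⟨w.map g, ?_, ?_, ?_⟩⟩
  · rintro ⟨cs, rfl, hn, hc⟩
    refine ⟨hn.map hl.injective, ?_⟩
    rw [List.isChain_map]
    simp only [hl _]
    exact hc
  · rw [List.map_map, hr.comp_eq_id, List.map_id]
  · exact hn.map hr.injective
  · exact (List.isChain_map g).2 hc

/-- The cell of the standard board that carries a given letter. -/
def stdCell : Fin 9 → Fin 3 × Fin 3 :=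
  ![(0, 0), (0, 1), (0, 2), (1, 2), (2, 2), (2, 1), (2, 0), (1, 0), (1, 1)]

theorem stdCell_leftInverse : Function.LeftInverse stdCell stdBoard := by
  unfold Function.LeftInverse; decide

theorem stdCell_rightInverse : Function.RightInverse stdCell stdBoard := by
  unfold Function.RightInverse Function.LeftInverse; decide

theorem swapCell_leftInverse :
    Function.LeftInverse (stdCell ∘ Equiv.swap (0 : Fin 9) 2) swapBoard :=
  fun c => by simp [swapBoard, stdCell_leftInverse c]

theorem swapCell_rightInverse :
    Function.RightInverse (stdCell ∘ Equiv.swap (0 : Fin 9) 2) swapBoard :=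
  fun a => by simp [swapBoard, stdCell_rightInverse _]

/-- The letters adjacent to a given letter on both `stdBoard` and `swapBoard`. -/
def commonNeighbors : Fin 9 → List (Fin 9) :=
  ![[1, 8], [0, 2, 3, 7, 8], [1, 8], [1, 4, 5, 8], [3, 5, 8], [3, 4, 6, 7, 8], [5, 7, 8],
    [1, 5, 6, 8], [0, 1, 2, 3, 4, 5, 6, 7]]

theorem mem_commonNeighbors_iff (a b : Fin 9) :
    b ∈ commonNeighbors a ↔ cellAdj (stdCell a) (stdCell b) ∧
      cellAdj (stdCell (Equiv.swap 0 2 a)) (stdCell (Equiv.swap 0 2 b)) := by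
  revert a b; decide +kernel

/-- The common four-letter words of `stdBoard` and `swapBoard`, as quadruples of letters. -/
def commonQuadruples : Finset (Fin 9 × Fin 9 × Fin 9 × Fin 9) :=
  Finset.univ.filter fun (a, b, c, d) =>
    (b ∈ commonNeighbors a ∧ c ∈ commonNeighbors b ∧ d ∈ commonNeighbors c) ∧ [a, b, c, d].Nodup

theorem card_commonQuadruples : commonQuadruples.card = 376 := by
  decide +kernel

theorem wordsOfLen_inter_eq_image :
    WordsOfLen stdBoard 4 ∩ WordsOfLen swapBoard 4 =
      (fun (a, b, c, d) => [a, b, c, d]) '' (commonQuadruples : Set _) := by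
  ext w
  simp only [WordsOfLen, Set.mem_inter_iff, Set.mem_ofPred_eq,
    isWordOf_iff_of_inverse stdCell_leftInverse stdCell_rightInverse,
    isWordOf_iff_of_inverse swapCell_leftInverse swapCell_rightInverse, Set.mem_image,
    commonQuadruples, Finset.coe_filter, Finset.mem_univ, true_and, Prod.exists,
    mem_commonNeighbors_iff, Function.comp_apply]
  constructor
  · rintro ⟨⟨h, -, hn, hs⟩, -, -, -, ht⟩
    obtain ⟨a, b, c, d, rfl⟩ := List.length_eq_four.1 h
    simp only [List.isChain_cons_cons, List.isChain_singleton, and_true] at hs ht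
    exact ⟨a, b, c, d, ⟨⟨⟨hs.1, ht.1⟩, ⟨hs.2.1, ht.2.1⟩, hs.2.2, ht.2.2⟩, hn⟩, rfl⟩
  · rintro ⟨a, b, c, d, ⟨⟨h₁, h₂, h₃⟩, hn⟩, rfl⟩
    simp [List.isChain_cons_cons, h₁, h₂, h₃, hn, -List.nodup_cons]

theorem not_boardEquiv_stdBoard_swapBoard : ¬ BoardEquiv stdBoard swapBoard := by
  rintro ⟨σ, hσ, h⟩
  simp only [squareSymm, Set.mem_insert_iff, Set.mem_singleton_iff] at hσ
  rcases hσ with rfl | rfl | rfl | rfl | rfl | rfl | rfl | rfl <;>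
    exact absurd h (by decide)

/-- The standard board and the board obtained by swapping its two upper corners are
not equivalent, yet they share exactly 376 4-letter words. -/
theorem common_words_count :
    ¬ BoardEquiv stdBoard swapBoard ∧
      (WordsOfLen stdBoard 4 ∩ WordsOfLen swapBoard 4).ncard = 376 := by
  refine ⟨not_boardEquiv_stdBoard_swapBoard, ?_⟩
  rw [wordsOfLen_inter_eq_image, Set.ncard_image_of_injective, Set.ncard_coe_finset,
    card_commonQuadruples]
  rintro ⟨a₁, b₁, c₁, d₁⟩ ⟨a₂, b₂, c₂, d₂⟩ h
  simpa using h
end
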